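/- arXiv:2512.13940 — 2 statements merged into one kernel-verified Lean document; each statement's English description precedes it below -/
import Mathlib

section
/- Let σ_f, σ_l > 0, let k be the Gaussian kernel on ℝⁿ, let P and Q be Borel probability measures on ℝⁿ, and let π be any coupling of P and Q, i.e., a Borel probability measure on ℝⁿ × ℝⁿ whose first marginal is P and whose second marginal is Q. If ∫ ‖y − y'‖ dπ(y, y') < ∞, then MMD²(P, Q) ≤ (σ_f² / σ_l²) · (∫ ‖y − y'‖ dπ(y, y'))². -/
open MeasureTheory

/-- The Gaussian kernel on `ℝⁿ` with parameters `σf, σl`. -/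
noncomputable def gaussianKernel (σf σl : ℝ) {n : ℕ}
    (x y : EuclideanSpace ℝ (Fin n)) : ℝ :=
  σf ^ 2 * Real.exp (-‖x - y‖ ^ 2 / (2 * σl ^ 2))

/-- Squared maximum mean discrepancy w.r.t. the kernel `k`. -/
noncomputable def mmdSq {n : ℕ}
    (k : EuclideanSpace ℝ (Fin n) → EuclideanSpace ℝ (Fin n) → ℝ)
    (P Q : Measure (EuclideanSpace ℝ (Fin n))) : ℝ :=
  (∫ y, (∫ y', k y y' ∂P) ∂P) + (∫ y, (∫ y', k y y' ∂Q) ∂Q)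
    - 2 * ∫ y, (∫ y', k y y' ∂Q) ∂P

open scoped InnerProductSpace

section GaussianCalculus

variable {E : Type*} [NormedAddCommGroup E] [InnerProductSpace ℝ E]

theorem hasFDerivAt_exp_neg_norm_sq_div_two (z : E) :
    HasFDerivAt (fun z : E => Real.exp (-‖z‖ ^ 2 / 2))
      (-(Real.exp (-‖z‖ ^ 2 / 2)) • innerSL ℝ z) z := by
  have h := (((hasStrictFDerivAt_norm_sq z).hasFDerivAt.neg).mul_const (1 / 2 : ℝ)).exp
  convert h using 1
  · ext w
    simp [div_eq_mul_inv]
  · ext w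
    simp [div_eq_mul_inv]

theorem hasFDerivAt_exp_neg_norm_sq_div_two_smul (z : E) :
    HasFDerivAt (fun z : E => Real.exp (-‖z‖ ^ 2 / 2) • z)
      (Real.exp (-‖z‖ ^ 2 / 2) • ContinuousLinearMap.id ℝ E +
        (-(Real.exp (-‖z‖ ^ 2 / 2)) • innerSL ℝ z).smulRight z) z :=
  (hasFDerivAt_exp_neg_norm_sq_div_two z).fun_smul (hasFDerivAt_id z)

theorem norm_sub_inner_smul_le (z u : E) :
    ‖u - ⟪z, u⟫_ℝ • z‖ ≤ Real.exp (‖z‖ ^ 2 / 2) * ‖u‖ := by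
  refine abs_le_of_sq_le_sq' ?_ (by positivity) |>.2
  have hsq : ‖u - ⟪z, u⟫_ℝ • z‖ ^ 2
      = ‖u‖ ^ 2 - 2 * ⟪z, u⟫_ℝ ^ 2 + ⟪z, u⟫_ℝ ^ 2 * ‖z‖ ^ 2 := by
    rw [norm_sub_sq_real, inner_smul_right, norm_smul, real_inner_comm z u, mul_pow,
      Real.norm_eq_abs, sq_abs]
    ring
  have hcs : ⟪z, u⟫_ℝ ^ 2 ≤ ‖z‖ ^ 2 * ‖u‖ ^ 2 := by
    rw [← mul_pow]
    exact sq_le_sq.2 ((abs_real_inner_le_norm z u).trans (le_abs_self _))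
  have hexp := Real.quadratic_le_exp_of_nonneg (x := ‖z‖ ^ 2 / 2) (by positivity)
  have hu := sq_nonneg ‖u‖
  have hc := sq_nonneg ⟪z, u⟫_ℝ
  have hr0 := sq_nonneg ‖z‖
  rw [hsq, mul_pow]
  generalize ‖z‖ ^ 2 = r at *
  generalize ⟪z, u⟫_ℝ ^ 2 = c at *
  generalize ‖u‖ ^ 2 = s at *
  generalize Real.exp (r / 2) = e at *
  rcases le_total r 2 with hr | hr
  · have he : 1 ≤ e ^ 2 := by nlinarith
    nlinarith
  · have he : r - 1 ≤ e := by nlinarith [sq_nonneg (r - 2)]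
    have he2 : (r - 1) ^ 2 ≤ e ^ 2 := by gcongr; linarith
    nlinarith [mul_le_mul_of_nonneg_right he2 hu]

theorem norm_exp_neg_norm_sq_div_two_smul_sub_le (x y : E) :
    ‖Real.exp (-‖y‖ ^ 2 / 2) • y - Real.exp (-‖x‖ ^ 2 / 2) • x‖ ≤ ‖y - x‖ := by
  have h := convex_univ.norm_image_sub_le_of_norm_hasFDerivWithin_le (𝕜 := ℝ) (C := 1)
    (fun z _ => (hasFDerivAt_exp_neg_norm_sq_div_two_smul (E := E) z).hasFDerivWithinAt) ?_
    (Set.mem_univ x) (Set.mem_univ y)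
  · simpa using h
  intro z _
  refine ContinuousLinearMap.opNorm_le_bound _ zero_le_one fun u => ?_
  have h : (Real.exp (-‖z‖ ^ 2 / 2) • ContinuousLinearMap.id ℝ E +
      (-(Real.exp (-‖z‖ ^ 2 / 2)) • innerSL ℝ z).smulRight z) u
      = Real.exp (-‖z‖ ^ 2 / 2) • (u - ⟪z, u⟫_ℝ • z) := by
    simp [smul_smul, sub_eq_add_neg]
  rw [h, norm_smul, Real.norm_eq_abs, Real.abs_exp, one_mul]
  calc _ ≤ Real.exp (-‖z‖ ^ 2 / 2) * (Real.exp (‖z‖ ^ 2 / 2) * ‖u‖) := by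
        gcongr
        exact norm_sub_inner_smul_le z u
    _ = ‖u‖ := by
        rw [← mul_assoc, ← Real.exp_add, neg_div, neg_add_cancel, Real.exp_zero, one_mul]

theorem exp_neg_norm_sq_div_two_mixed_difference_le (a u v : E) :
    Real.exp (-‖a‖ ^ 2 / 2) + Real.exp (-‖a + u + v‖ ^ 2 / 2)
      - Real.exp (-‖a + v‖ ^ 2 / 2) - Real.exp (-‖a + u‖ ^ 2 / 2) ≤ ‖u‖ * ‖v‖ := by
  have hderiv (x : E) := ((hasFDerivAt_exp_neg_norm_sq_div_two (x + v)).comp x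
    ((hasFDerivAt_id x).add_const v)).sub (hasFDerivAt_exp_neg_norm_sq_div_two x)
  have h := convex_univ.norm_image_sub_le_of_norm_hasFDerivWithin_le (𝕜 := ℝ) (C := ‖v‖)
    (fun x _ => (hderiv x).hasFDerivWithinAt) ?_ (Set.mem_univ a) (Set.mem_univ (a + u))
  · have h' := (le_abs_self _).trans h
    simp only [Function.comp_apply, id, Pi.sub_apply, add_sub_cancel_left] at h'
    linarith
  intro x _
  refine ContinuousLinearMap.opNorm_le_bound _ (norm_nonneg v) fun w => ?_
  have hL := norm_exp_neg_norm_sq_div_two_smul_sub_le (x + v) x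
  rw [sub_add_cancel_left, norm_neg] at hL
  have heq : ((-(Real.exp (-‖x + v‖ ^ 2 / 2)) • innerSL ℝ (x + v)).comp
      (ContinuousLinearMap.id ℝ E) - -(Real.exp (-‖x‖ ^ 2 / 2)) • innerSL ℝ x) w
      = ⟪Real.exp (-‖x‖ ^ 2 / 2) • x - Real.exp (-‖x + v‖ ^ 2 / 2) • (x + v), w⟫_ℝ := by
    simp only [ContinuousLinearMap.comp_id, sub_apply,
      smul_apply, innerSL_apply_apply, inner_sub_left, real_inner_smul_left,
      smul_eq_mul]
    ring
  refine (congrArg norm heq).trans_le ?_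
  exact (norm_inner_le_norm _ _).trans (by gcongr)

end GaussianCalculus

theorem gaussianKernel_comm (σf σl : ℝ) {n : ℕ} (x y : EuclideanSpace ℝ (Fin n)) :
    gaussianKernel σf σl x y = gaussianKernel σf σl y x := by
  simp only [gaussianKernel, norm_sub_rev]

theorem continuous_gaussianKernel (σf σl : ℝ) {n : ℕ} :
    Continuous fun p : EuclideanSpace ℝ (Fin n) × EuclideanSpace ℝ (Fin n) =>
      gaussianKernel σf σl p.1 p.2 := by
  unfold gaussianKernel
  fun_prop

theorem norm_gaussianKernel_le (σf σl : ℝ) {n : ℕ} (x y : EuclideanSpace ℝ (Fin n)) :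
    ‖gaussianKernel σf σl x y‖ ≤ σf ^ 2 := by
  rw [gaussianKernel, Real.norm_of_nonneg (by positivity)]
  refine mul_le_of_le_one_right (sq_nonneg _) (Real.exp_le_one_iff.2 ?_)
  rw [neg_div]
  exact neg_nonpos.2 (by positivity)

theorem gaussianKernel_mixed_difference_le (σf : ℝ) {σl : ℝ} (hσl : 0 < σl) {n : ℕ}
    (x y x' y' : EuclideanSpace ℝ (Fin n)) :
    gaussianKernel σf σl x x' + gaussianKernel σf σl y y'
      - gaussianKernel σf σl x y' - gaussianKernel σf σl y x'
      ≤ σf ^ 2 / σl ^ 2 * (‖x - y‖ * ‖x' - y'‖) := by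
  have hk (p q : EuclideanSpace ℝ (Fin n)) :
      gaussianKernel σf σl p q = σf ^ 2 * Real.exp (-‖σl⁻¹ • (p - q)‖ ^ 2 / 2) := by
    rw [gaussianKernel, norm_smul, mul_pow, Real.norm_eq_abs, sq_abs]
    congr 2
    field_simp
  have h := exp_neg_norm_sq_div_two_mixed_difference_le
    (σl⁻¹ • (x - x')) (σl⁻¹ • (y - x)) (σl⁻¹ • (x' - y'))
  simp only [← smul_add, sub_add_sub_cancel, sub_add_sub_cancel', norm_smul σl⁻¹ (y - x),
    norm_smul σl⁻¹ (x' - y'), norm_sub_rev y x, Real.norm_eq_abs, abs_inv, abs_of_pos hσl] at h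
  simp only [hk]
  have hscale : σf ^ 2 / σl ^ 2 * (‖x - y‖ * ‖x' - y'‖)
      = σf ^ 2 * (σl⁻¹ * ‖x - y‖ * (σl⁻¹ * ‖x' - y'‖)) := by
    field_simp
  rw [hscale, ← mul_add, ← mul_sub, ← mul_sub]
  exact mul_le_mul_of_nonneg_left h (sq_nonneg σf)

theorem integral_integral_map_map {Ω Ω' X Y : Type*} [MeasurableSpace Ω] [MeasurableSpace Ω']
    [MeasurableSpace X] [MeasurableSpace Y] {μ : Measure Ω} {ν : Measure Ω'} [SFinite ν]
    {f : Ω → X} {g : Ω' → Y} (hf : Measurable f) (hg : Measurable g) {k : X → Y → ℝ}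
    (hk : StronglyMeasurable (Function.uncurry k)) :
    ∫ x, ∫ y, k x y ∂(ν.map g) ∂(μ.map f) = ∫ p, ∫ q, k (f p) (g q) ∂ν ∂μ := by
  rw [integral_map hf.aemeasurable hk.integral_prod_right.aestronglyMeasurable]
  refine integral_congr_ae (.of_forall fun p => ?_)
  exact integral_map hg.aemeasurable
    (hk.comp_measurable measurable_prodMk_left).aestronglyMeasurable

theorem mmdSq_le_of_coupling {n : ℕ} (σf σl : ℝ) (hσf : 0 < σf) (hσl : 0 < σl)
    (k : EuclideanSpace ℝ (Fin n) → EuclideanSpace ℝ (Fin n) → ℝ)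
    (hk : k = gaussianKernel σf σl)
    (P Q : Measure (EuclideanSpace ℝ (Fin n)))
    [IsProbabilityMeasure P] [IsProbabilityMeasure Q]
    (π : Measure (EuclideanSpace ℝ (Fin n) × EuclideanSpace ℝ (Fin n)))
    [IsProbabilityMeasure π]
    (hfst : π.map Prod.fst = P) (hsnd : π.map Prod.snd = Q)
    (hint : Integrable (fun p => ‖p.1 - p.2‖) π) :
    mmdSq k P Q ≤ (σf ^ 2 / σl ^ 2) * (∫ p, ‖p.1 - p.2‖ ∂π) ^ 2 := by
  subst hk hfst hsnd
  have hmeas : StronglyMeasurable (Function.uncurry (gaussianKernel σf σl (n := n))) :=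
    (continuous_gaussianKernel σf σl).stronglyMeasurable
  have hI {f g : EuclideanSpace ℝ (Fin n) × EuclideanSpace ℝ (Fin n) → EuclideanSpace ℝ (Fin n)}
      (hf : Measurable f) (hg : Measurable g) :
      Integrable (fun z => gaussianKernel σf σl (f z.1) (g z.2)) (π.prod π) :=
    .of_bound (hmeas.comp_measurable
        ((hf.comp measurable_fst).prodMk (hg.comp measurable_snd))).aestronglyMeasurable
      (σf ^ 2) (.of_forall fun z => norm_gaussianKernel_le σf σl _ _)
  have hprod {f g : EuclideanSpace ℝ (Fin n) × EuclideanSpace ℝ (Fin n) → EuclideanSpace ℝ (Fin n)}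
      (hf : Measurable f) (hg : Measurable g) :
      ∫ x, ∫ y, gaussianKernel σf σl x y ∂(π.map g) ∂(π.map f)
        = ∫ z, gaussianKernel σf σl (f z.1) (g z.2) ∂(π.prod π) := by
    rw [integral_integral_map_map hf hg hmeas, integral_prod _ (hI hf hg)]
  have h11 := hI measurable_fst measurable_fst
  have h22 := hI measurable_snd measurable_snd
  have h12 := hI measurable_fst measurable_snd
  have h21 := hI measurable_snd measurable_fst
  have hadd : Integrable (fun z => gaussianKernel σf σl z.1.1 z.2.1
      + gaussianKernel σf σl z.1.2 z.2.2) (π.prod π) := h11.add h22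
  have hsub : Integrable (fun z => gaussianKernel σf σl z.1.1 z.2.1
      + gaussianKernel σf σl z.1.2 z.2.2 - gaussianKernel σf σl z.1.1 z.2.2) (π.prod π) :=
    hadd.sub h12
  have hswap : ∫ z, gaussianKernel σf σl z.1.1 z.2.2 ∂(π.prod π)
      = ∫ z, gaussianKernel σf σl z.1.2 z.2.1 ∂(π.prod π) := by
    rw [← integral_prod_swap]
    exact integral_congr_ae (.of_forall fun z => gaussianKernel_comm _ _ _ _)
  calc mmdSq (gaussianKernel σf σl) (π.map Prod.fst) (π.map Prod.snd)
      = ∫ z, (gaussianKernel σf σl z.1.1 z.2.1 + gaussianKernel σf σl z.1.2 z.2.2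
          - gaussianKernel σf σl z.1.1 z.2.2 - gaussianKernel σf σl z.1.2 z.2.1)
          ∂(π.prod π) := by
        rw [integral_sub hsub h21, integral_sub hadd h12,
          integral_add h11 h22, ← hswap, mmdSq, hprod measurable_fst measurable_fst,
          hprod measurable_snd measurable_snd, hprod measurable_fst measurable_snd]
        ring
    _ ≤ ∫ z, σf ^ 2 / σl ^ 2 * (‖z.1.1 - z.1.2‖ * ‖z.2.1 - z.2.2‖) ∂(π.prod π) :=
        integral_mono (hsub.sub h21) ((hint.mul_prod hint).const_mul _)
          fun z => gaussianKernel_mixed_difference_le σf hσl _ _ _ _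
    _ = σf ^ 2 / σl ^ 2 * (∫ p, ‖p.1 - p.2‖ ∂π) ^ 2 := by
        rw [integral_const_mul, sq (∫ p, ‖p.1 - p.2‖ ∂π), ← integral_prod_mul]
end

section
/- (Deterministic core of Theorem 3.2) Let σ_f, σ_l > 0, let k be the Gaussian kernel on ℝⁿ, let (W, 𝒲) be a measurable space, P_w a probability measure on W, and f : ℝⁿ × W → ℝⁿ measurable with ‖f(x, w) − f(x̃, w)‖ ≤ L ‖x − x̃‖ for all x, x̃ ∈ ℝⁿ, w ∈ W, where L ≥ 0; define T(· | x) := pushforward of P_w under w ↦ f(x, w). Let η > 0, ε' ≥ 0, let x, x̃ ∈ ℝⁿ with ‖x − x̃‖ ≤ η, and let T̂ be any Borel probability measure on ℝⁿ with √(MMD²(T(· | x̃), T̂)) ≤ ε'. Then √(MMD²(T(· | x), T̂)) ≤ (σ_f / σ_l) L η + ε'. -/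
open MeasureTheory

section MeanEmbedding

variable {n : ℕ} {H : Type*} [NormedAddCommGroup H] [InnerProductSpace ℂ H]

/-- The Gaussian kernel is realised by a feature map into a complex Hilbert space. -/
theorem exists_gaussianKernel_featureMap (σf σl : ℝ) (n : ℕ) :
    ∃ (H : Type) (_ : NormedAddCommGroup H) (_ : InnerProductSpace ℂ H) (_ : CompleteSpace H)
      (Φ : EuclideanSpace ℝ (Fin n) → H),
      ∀ y y', inner ℂ (Φ y) (Φ y') = (gaussianKernel σf σl y y' : ℂ) := by
  set γ := ProbabilityTheory.stdGaussian (EuclideanSpace ℝ (Fin n))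
  let e : EuclideanSpace ℝ (Fin n) → EuclideanSpace ℝ (Fin n) → ℂ :=
    fun y t => σf * Complex.exp ((inner ℝ t (σl⁻¹ • y) : ℝ) * Complex.I)
  have he : ∀ y, MemLp (e y) 2 γ := fun y => by
    refine MemLp.of_bound (C := |σf|) ?_ (.of_forall fun t => ?_)
    · exact Continuous.aestronglyMeasurable (by fun_prop)
    · simp [e, Complex.norm_exp_ofReal_mul_I]
  refine ⟨Lp ℂ 2 γ, inferInstance, inferInstance, inferInstance, fun y => (he y).toLp,
    fun y y' => ?_⟩
  rw [L2.inner_def]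
  calc
    _ = ∫ t, (σf : ℂ) ^ 2 *
          Complex.exp ((inner ℝ t (σl⁻¹ • y' - σl⁻¹ • y) : ℝ) * Complex.I) ∂γ := by
      refine integral_congr_ae ?_
      filter_upwards [(he y).coeFn_toLp, (he y').coeFn_toLp] with t h h'
      rw [h, h']
      simp only [e, RCLike.inner_apply, map_mul, Complex.conj_ofReal, ← Complex.exp_conj,
        Complex.conj_I, inner_sub_right, Complex.ofReal_sub, sub_mul, Complex.exp_sub, mul_neg,
        Complex.exp_neg]
      ring
    _ = _ := by
      rw [integral_const_mul, ← charFun_apply, ProbabilityTheory.charFun_stdGaussian,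
        ← smul_sub, norm_smul, gaussianKernel, norm_sub_rev]
      push_cast
      congr 2
      rw [mul_pow, ← Complex.ofReal_pow ‖σl⁻¹‖, Real.norm_eq_abs, sq_abs]
      push_cast
      rw [inv_pow, div_eq_mul_inv, div_eq_mul_inv, mul_inv]
      ring

theorem norm_sq_of_inner_eq_gaussianKernel {σf σl : ℝ} {Φ : EuclideanSpace ℝ (Fin n) → H}
    (hΦ : ∀ y y', inner ℂ (Φ y) (Φ y') = (gaussianKernel σf σl y y' : ℂ))
    (y : EuclideanSpace ℝ (Fin n)) : ‖Φ y‖ ^ 2 = σf ^ 2 := by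
  rw [← inner_self_eq_norm_sq (𝕜 := ℂ), hΦ]
  simp only [gaussianKernel, RCLike.re_to_complex, Complex.ofReal_re]
  simp

theorem norm_sub_le_of_inner_eq_gaussianKernel {σf σl : ℝ} (hσf : 0 ≤ σf) (hσl : 0 < σl)
    {Φ : EuclideanSpace ℝ (Fin n) → H}
    (hΦ : ∀ y y', inner ℂ (Φ y) (Φ y') = (gaussianKernel σf σl y y' : ℂ))
    (y y' : EuclideanSpace ℝ (Fin n)) : ‖Φ y - Φ y'‖ ≤ σf / σl * ‖y - y'‖ := by
  refine le_of_sq_le_sq ?_ (by positivity)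
  rw [norm_sub_sq (𝕜 := ℂ), norm_sq_of_inner_eq_gaussianKernel hΦ, norm_sq_of_inner_eq_gaussianKernel hΦ,
    hΦ]
  have hexp := Real.add_one_le_exp (-‖y - y'‖ ^ 2 / (2 * σl ^ 2))
  have hmul := mul_le_mul_of_nonneg_left hexp (sq_nonneg σf)
  have heq : (σf / σl * ‖y - y'‖) ^ 2 =
      2 * σf ^ 2 - 2 * (σf ^ 2 * (-‖y - y'‖ ^ 2 / (2 * σl ^ 2) + 1)) := by
    field_simp
    ring
  rw [heq]
  simp only [gaussianKernel, RCLike.re_to_complex, Complex.ofReal_re]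
  linarith

theorem inner_integral_integral [CompleteSpace H] {P Q : Measure (EuclideanSpace ℝ (Fin n))}
    {k : EuclideanSpace ℝ (Fin n) → EuclideanSpace ℝ (Fin n) → ℝ}
    {Φ : EuclideanSpace ℝ (Fin n) → H} (hP : Integrable Φ P) (hQ : Integrable Φ Q)
    (hΦ : ∀ y y', inner ℂ (Φ y) (Φ y') = (k y y' : ℂ)) :
    inner ℂ (∫ y, Φ y ∂P) (∫ y, Φ y ∂Q) = ((∫ y, (∫ y', k y y' ∂Q) ∂P : ℝ) : ℂ) := by
  have hright : ∀ y, inner ℂ (Φ y) (∫ y', Φ y' ∂Q) = ((∫ y', k y y' ∂Q : ℝ) : ℂ) := fun y => by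
    rw [← integral_inner hQ, ← integral_complex_ofReal]
    exact integral_congr_ae (.of_forall fun y' => hΦ y y')
  rw [← inner_conj_symm, ← integral_inner hP, ← integral_conj, ← integral_complex_ofReal]
  refine integral_congr_ae (.of_forall fun y => ?_)
  simp only [inner_conj_symm, hright]

/-- The squared MMD is the squared distance between kernel mean embeddings. -/
theorem mmdSq_eq_norm_sub_sq [CompleteSpace H] {P Q : Measure (EuclideanSpace ℝ (Fin n))}
    {k : EuclideanSpace ℝ (Fin n) → EuclideanSpace ℝ (Fin n) → ℝ}
    {Φ : EuclideanSpace ℝ (Fin n) → H} (hP : Integrable Φ P) (hQ : Integrable Φ Q)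
    (hΦ : ∀ y y', inner ℂ (Φ y) (Φ y') = (k y y' : ℂ)) :
    mmdSq k P Q = ‖∫ y, Φ y ∂P - ∫ y, Φ y ∂Q‖ ^ 2 := by
  rw [norm_sub_sq (𝕜 := ℂ), ← inner_self_eq_norm_sq (𝕜 := ℂ), ← inner_self_eq_norm_sq (𝕜 := ℂ),
    inner_integral_integral hP hP hΦ, inner_integral_integral hQ hQ hΦ,
    inner_integral_integral hP hQ hΦ, mmdSq]
  simp only [RCLike.re_to_complex, Complex.ofReal_re]
  ring

end MeanEmbedding

theorem mmd_deterministic_core {n : ℕ} (σf σl : ℝ)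
    (hσf : 0 < σf) (hσl : 0 < σl)
    (k : EuclideanSpace ℝ (Fin n) → EuclideanSpace ℝ (Fin n) → ℝ)
    (hk : k = gaussianKernel σf σl)
    {W : Type*} [MeasurableSpace W] (Pw : Measure W) [IsProbabilityMeasure Pw]
    (f : EuclideanSpace ℝ (Fin n) → W → EuclideanSpace ℝ (Fin n))
    (hf : ∀ x, Measurable (f x))
    (L : ℝ) (hL : 0 ≤ L)
    (hLip : ∀ x x' : EuclideanSpace ℝ (Fin n), ∀ w : W,
      ‖f x w - f x' w‖ ≤ L * ‖x - x'‖)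
    (T : EuclideanSpace ℝ (Fin n) → Measure (EuclideanSpace ℝ (Fin n)))
    (hT : ∀ x, T x = Pw.map (fun w => f x w))
    (η : ℝ) (hη : 0 < η) (ε' : ℝ) (hε' : 0 ≤ ε')
    (x x' : EuclideanSpace ℝ (Fin n)) (hxx : ‖x - x'‖ ≤ η)
    (That : Measure (EuclideanSpace ℝ (Fin n))) [IsProbabilityMeasure That]
    (hThat : Real.sqrt (mmdSq k (T x') That) ≤ ε') :
    Real.sqrt (mmdSq k (T x) That) ≤ (σf / σl) * L * η + ε' := by
  subst hk
  obtain ⟨H, _, _, _, Φ, hΦ⟩ := exists_gaussianKernel_featureMap σf σl n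
  have hΦ_dist := norm_sub_le_of_inner_eq_gaussianKernel hσf.le hσl hΦ
  have hΦ_cont : Continuous Φ :=
    (LipschitzWith.of_dist_le' fun y y' => by
      simpa only [dist_eq_norm] using hΦ_dist y y').continuous
  have hΦ_norm : ∀ y, ‖Φ y‖ ≤ σf := fun y =>
    le_of_sq_le_sq (norm_sq_of_inner_eq_gaussianKernel hΦ y).le hσf.le
  have hΦ_int : ∀ (P : Measure (EuclideanSpace ℝ (Fin n))) [IsProbabilityMeasure P],
      Integrable Φ P := fun P _ =>
    .of_bound hΦ_cont.aestronglyMeasurable σf (.of_forall hΦ_norm)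
  have hT_prob : ∀ z, IsProbabilityMeasure (T z) := fun z => by
    rw [hT]
    exact Measure.isProbabilityMeasure_map (hf z).aemeasurable
  have hmmd : ∀ z, Real.sqrt (mmdSq (gaussianKernel σf σl) (T z) That) =
      ‖∫ y, Φ y ∂(T z) - ∫ y, Φ y ∂That‖ := fun z => by
    rw [mmdSq_eq_norm_sub_sq (hΦ_int _) (hΦ_int _) hΦ, Real.sqrt_sq (norm_nonneg _)]
  have hstep : ‖∫ y, Φ y ∂(T x) - ∫ y, Φ y ∂(T x')‖ ≤ σf / σl * L * η := by
    have hint : ∀ z, Integrable (fun w => Φ (f z w)) Pw := fun z =>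
      .of_bound (hΦ_cont.comp_aestronglyMeasurable (hf z).aestronglyMeasurable) σf
        (.of_forall fun _ => hΦ_norm _)
    rw [hT, hT, integral_map (hf x).aemeasurable hΦ_cont.aestronglyMeasurable,
      integral_map (hf x').aemeasurable hΦ_cont.aestronglyMeasurable,
      ← integral_sub (hint x) (hint x')]
    refine (norm_integral_le_of_norm_le_const (C := σf / σl * L * η)
      (.of_forall fun w => ?_)).trans_eq (by simp)
    calc
      _ ≤ σf / σl * ‖f x w - f x' w‖ := hΦ_dist _ _
      _ ≤ σf / σl * (L * η) := by
        gcongr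
        exact (hLip x x' w).trans (by gcongr)
      _ = _ := by ring
  rw [hmmd] at hThat ⊢
  exact (norm_sub_le_norm_sub_add_norm_sub _ _ _).trans (add_le_add hstep hThat)
end
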